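/- There exists k > 0 such that for all λ = (λ₁,…,λₙ) ∈ ℝⁿ and all t ∈ ℝ, one has |Σ_{j=1}^{n} λ_j x_{+,j}(t)| ≥ k·|λ|·e^{t}. -/

import Mathlib

open Real Filter Topology

noncomputable section

/-- The phase space `ℝ^{2n} = ℝⁿ × ℝⁿ` with the Euclidean norm. -/
abbrev EucV (n : ℕ) := EuclideanSpace ℝ (Fin n ⊕ Fin n)

/-- The block matrix `A = [[0, I],[I, 0]]`, i.e. `A (y, z) = (z, y)`. -/
def Amap (n : ℕ) : EucV n →L[ℝ] EucV n :=
  LinearMap.toContinuousLinearMap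
    { toFun := fun x => (WithLp.equiv 2 _).symm fun i => x i.swap
      map_add' := fun _ _ => rfl
      map_smul' := fun _ _ => rfl }

/-- `x` is a solution of `x′(t) = (A + E(t))·x(t)`. -/
def IsSol (n : ℕ) (E : ℝ → (EucV n →L[ℝ] EucV n)) (x : ℝ → EucV n) : Prop :=
  ∀ t : ℝ, HasDerivAt x (Amap n (x t) + E t (x t)) t

/-- The eigenvector `e_j^σ = (e_j, σ e_j)` of `A`, for `σ = ±1`. -/
def eVec (n : ℕ) (σ : ℝ) (j : Fin n) : EucV n :=
  EuclideanSpace.single (Sum.inl j) (1 : ℝ) + EuclideanSpace.single (Sum.inr j) σ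

/-- The block swap `A` is an isometry. -/
lemma norm_Amap_apply (n : ℕ) (x : EucV n) : ‖Amap n x‖ = ‖x‖ := by
  rw [EuclideanSpace.norm_eq, EuclideanSpace.norm_eq]
  congr 1
  exact Equiv.sum_comp (Equiv.sumComm (Fin n) (Fin n)) fun i => ‖x i‖ ^ 2

lemma exp_neg_abs_le (t : ℝ) : Real.exp (-|t|) ≤ 2 * (1 / (1 + t ^ 2)) := by
  have h := Real.quadratic_le_exp_of_nonneg (abs_nonneg t)
  rw [sq_abs] at h
  have ht := abs_nonneg t
  rw [Real.exp_neg, ← one_div, mul_one_div, div_le_div_iff₀ (Real.exp_pos _) (by positivity)]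
  linarith

lemma IsSol.sum_smul {n : ℕ} {E : ℝ → (EucV n →L[ℝ] EucV n)} {ι : Type*} {s : Finset ι}
    {x : ι → ℝ → EucV n} (hx : ∀ j ∈ s, IsSol n E (x j)) (c : ι → ℝ) :
    IsSol n E fun t => ∑ j ∈ s, c j • x j t := by
  intro t
  have h := HasDerivAt.fun_sum fun j hj => (hx j hj t).const_smul (c j)
  simp only [smul_add, Finset.sum_add_distrib] at h
  simp only [map_sum, map_smul]
  exact h

/-- The squared norm of a solution, renormalised by an integrating factor that dominates the growth
rate `2 (1 + ‖E t‖)`, is nonincreasing. -/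
lemma IsSol.antitone_norm_sq {n : ℕ} {E : ℝ → (EucV n →L[ℝ] EucV n)} {C : ℝ} (hC : 0 ≤ C)
    (hE : ∀ t : ℝ, ‖E t‖ ≤ C * Real.exp (-|t|)) {x : ℝ → EucV n} (hx : IsSol n E x) :
    Antitone fun t => ‖x t‖ ^ 2 * Real.exp (-2 * t - 4 * C * Real.arctan t) := by
  have hd (t : ℝ) := (hx t).norm_sq.mul ((((hasDerivAt_id t).const_mul (-2)).sub
    ((Real.hasDerivAt_arctan t).const_mul (4 * C))).exp)
  refine antitone_of_hasDerivAt_nonpos hd fun t => ?_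
  have hin : inner ℝ (x t) (Amap n (x t) + E t (x t)) ≤
      ‖x t‖ ^ 2 * (1 + C * (2 * (1 / (1 + t ^ 2)))) := by
    have h1 : ‖Amap n (x t) + E t (x t)‖ ≤ ‖x t‖ + C * (2 * (1 / (1 + t ^ 2))) * ‖x t‖ := by
      refine (norm_add_le _ _).trans ?_
      rw [norm_Amap_apply]
      have h2 := (hE t).trans (mul_le_mul_of_nonneg_left (exp_neg_abs_le t) hC)
      gcongr
      exact (E t).le_of_opNorm_le h2 _
    calc inner ℝ (x t) (Amap n (x t) + E t (x t))
        ≤ ‖x t‖ * ‖Amap n (x t) + E t (x t)‖ := real_inner_le_norm _ _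
      _ ≤ ‖x t‖ * (‖x t‖ + C * (2 * (1 / (1 + t ^ 2))) * ‖x t‖) := by gcongr
      _ = _ := by ring
  simp only [id]
  have hpos := Real.exp_pos (-2 * t - 4 * C * Real.arctan t)
  calc _ = 2 * Real.exp (-2 * t - 4 * C * Real.arctan t) *
        (inner ℝ (x t) (Amap n (x t) + E t (x t)) -
          ‖x t‖ ^ 2 * (1 + C * (2 * (1 / (1 + t ^ 2))))) := by
        simp only [Pi.sub_apply]
        ring
    _ ≤ 0 := mul_nonpos_of_nonneg_of_nonpos (by positivity) (sub_nonpos.2 hin)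

/-- A solution asymptotic to `e^t v` at `+∞` grows at least like `‖v‖ e^t` on all of `ℝ`. -/
lemma IsSol.lower_bound {n : ℕ} {E : ℝ → (EucV n →L[ℝ] EucV n)} {C : ℝ} (hC : 0 ≤ C)
    (hE : ∀ t : ℝ, ‖E t‖ ≤ C * Real.exp (-|t|)) {x : ℝ → EucV n} (hx : IsSol n E x) {v : EucV n}
    (hv : Tendsto (fun t : ℝ => Real.exp (-t) • x t) atTop (𝓝 v)) (t : ℝ) :
    Real.exp (-(2 * C * π)) * ‖v‖ * Real.exp t ≤ ‖x t‖ := by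
  have hlim : Tendsto (fun s => ‖x s‖ ^ 2 * Real.exp (-2 * s - 4 * C * Real.arctan s)) atTop
      (𝓝 (‖v‖ ^ 2 * Real.exp (-(4 * C * (π / 2))))) := by
    have ha : Tendsto Real.arctan atTop (𝓝 (π / 2)) :=
      Real.tendsto_arctan_atTop.mono_right nhdsWithin_le_nhds
    refine ((hv.norm.pow 2).mul ((ha.const_mul (4 * C)).neg.rexp)).congr fun s => ?_
    rw [norm_smul, Real.norm_of_nonneg (Real.exp_pos _).le, mul_pow, ← Real.exp_nat_mul,
      mul_comm (Real.exp _), mul_assoc, ← Real.exp_add]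
    congr 2
    push_cast
    ring
  have h := (hx.antitone_norm_sq hC hE).le_of_tendsto hlim t
  refine (sq_le_sq₀ (by positivity) (norm_nonneg _)).1 ?_
  have harc : -4 * C * Real.arctan t ≤ 2 * C * π := by
    nlinarith [Real.neg_pi_div_two_lt_arctan t]
  have h' : ‖v‖ ^ 2 * Real.exp (-(4 * C * (π / 2))) ≤
      ‖x t‖ ^ 2 * Real.exp (-2 * t + 2 * C * π) := by
    refine h.trans ?_
    gcongr
    linarith
  calc (Real.exp (-(2 * C * π)) * ‖v‖ * Real.exp t) ^ 2
      = ‖v‖ ^ 2 * Real.exp (-(4 * C * (π / 2))) * Real.exp (2 * t - 2 * C * π) := by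
        rw [mul_assoc (_ ^ 2), ← Real.exp_add, mul_pow, mul_pow, ← Real.exp_nat_mul,
          ← Real.exp_nat_mul, mul_right_comm, ← Real.exp_add, mul_comm]
        congr 2
        push_cast
        ring
    _ ≤ ‖x t‖ ^ 2 * Real.exp (-2 * t + 2 * C * π) * Real.exp (2 * t - 2 * C * π) := by gcongr
    _ = ‖x t‖ ^ 2 := by
        rw [mul_assoc, ← Real.exp_add]
        simp

lemma norm_le_norm_sum_smul_eVec (n : ℕ) (σ : ℝ) (lam : EuclideanSpace ℝ (Fin n)) :
    ‖lam‖ ≤ ‖∑ j, lam j • eVec n σ j‖ := by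
  have hl (i : Fin n) : (∑ j, lam j • eVec n σ j) (Sum.inl i) = lam i := by
    simp [eVec, Finset.sum_apply, Pi.single_apply]
  rw [EuclideanSpace.norm_eq, EuclideanSpace.norm_eq, Fintype.sum_sum_type]
  refine Real.sqrt_le_sqrt ?_
  simp only [hl]
  exact le_add_of_nonneg_right (Finset.sum_nonneg fun _ _ => sq_nonneg _)

/-- Lower bound `|Σ λ_j x_{+,j}(t)| ≥ k |λ| e^{t}`, uniform in `λ ∈ ℝⁿ` and `t ∈ ℝ`. -/
theorem lower_bound_unstable_combination
    (n : ℕ) (hn : 1 ≤ n)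
    (E : ℝ → (EucV n →L[ℝ] EucV n)) (hE : Continuous E)
    (C₀ : ℝ) (hC₀ : 0 < C₀)
    (hEb : ∀ t : ℝ, ‖E t‖ ≤ C₀ * Real.exp (-|t|))
    (xp xm : Fin n → ℝ → EucV n)
    (hxp : ∀ j, IsSol n E (xp j)) (hxm : ∀ j, IsSol n E (xm j))
    (hxpAsymp : ∀ j, Tendsto (fun t : ℝ => Real.exp (-t) • xp j t) atTop (𝓝 (eVec n 1 j)))
    (hxmAsymp : ∀ j, Tendsto (fun t : ℝ => Real.exp t • xm j t) atTop (𝓝 (eVec n (-1) j))) :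
    ∃ k : ℝ, 0 < k ∧ ∀ (lam : EuclideanSpace ℝ (Fin n)) (t : ℝ),
      k * ‖lam‖ * Real.exp t ≤ ‖∑ j : Fin n, lam j • xp j t‖ := by
  refine ⟨Real.exp (-(2 * C₀ * π)), Real.exp_pos _, fun lam t => ?_⟩
  have hlim : Tendsto (fun t : ℝ => Real.exp (-t) • ∑ j, lam j • xp j t) atTop
      (𝓝 (∑ j, lam j • eVec n 1 j)) := by
    refine (tendsto_finsetSum _ fun j _ => (hxpAsymp j).const_smul (lam j)).congr fun s => ?_
    rw [Finset.smul_sum]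
    exact Finset.sum_congr rfl fun j _ => smul_comm _ _ _
  refine le_trans ?_
    ((IsSol.sum_smul (fun j _ => hxp j) fun j => lam j).lower_bound hC₀.le hEb hlim t)
  gcongr
  exact norm_le_norm_sum_smul_eVec n 1 lam

end
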